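/- Let T be a tree of diameter at least 6 with vertex set {v_1, ..., v_n}, and let s_1, ..., s_n be integers with s_i ≥ 2 for all i. Then d̄(T(s_1, ..., s_n)) = d(T); that is, T(s_1, ..., s_n) belongs to class C_0. -/

import Mathlib

open SimpleGraph

variable {V : Type*}

/-- `D` is an orientation of `G`: every arc of `D` is an edge of `G`, and every edge of `G`
receives exactly one of the two possible directions. -/
def IsOrientation (G : SimpleGraph V) (D : V → V → Prop) : Prop :=
  (∀ u v, D u v → G.Adj u v) ∧ ∀ u v, G.Adj u v → (D u v ↔ ¬ D v u)

/-- There is a directed walk of length `n` from `u` to `v` in the digraph `D`. -/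
def DPath (D : V → V → Prop) : ℕ → V → V → Prop
  | 0, u, v => u = v
  | n + 1, u, v => ∃ w, D u w ∧ DPath D n w v

/-- Directed distance from `u` to `v` (`⊤` if `v` is not reachable from `u`). -/
noncomputable def ddist (D : V → V → Prop) (u v : V) : ℕ∞ :=
  sInf {n : ℕ∞ | ∃ m : ℕ, n = (m : ℕ∞) ∧ DPath D m u v}

/-- Diameter of a digraph: supremum of directed distances over all ordered pairs. -/
noncomputable def odiam (D : V → V → Prop) : ℕ∞ :=
  ⨆ u : V, ⨆ v : V, ddist D u v

/-- A strong orientation of `G`: an orientation in which every vertex is reachable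
from every other vertex by a directed path. -/
def IsStrongOrientation (G : SimpleGraph V) (D : V → V → Prop) : Prop :=
  IsOrientation G D ∧ ∀ u v, ∃ m : ℕ, DPath D m u v

/-- The orientation number of `G`: minimum diameter over all strong orientations. -/
noncomputable def orientNum (G : SimpleGraph V) : ℕ∞ :=
  sInf {d : ℕ∞ | ∃ D : V → V → Prop, IsStrongOrientation G D ∧ d = odiam D}

/-- The vertex-multiplication `G(s)`: vertex `v` is replaced by `s v` copies, and copies of
`v_i`, `v_j` are adjacent iff `v_i v_j` is an edge of `G` (whence `i ≠ j`). -/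
def vertexMult (G : SimpleGraph V) (s : V → ℕ) : SimpleGraph (Σ v : V, Fin (s v)) where
  Adj x y := G.Adj x.1 y.1
  symm := ⟨fun _ _ h => G.symm.symm _ _ h⟩
  loopless := ⟨fun x h => G.loopless.irrefl x.1 h⟩

/-- Eccentricity of a vertex. -/
noncomputable def ecc (G : SimpleGraph V) (v : V) : ℕ∞ :=
  ⨆ u : V, G.edist v u

/-! ### Directed walks -/

theorem DPath.trans {D : V → V → Prop} {m n : ℕ} {u v w : V} (h₁ : DPath D m u v)
    (h₂ : DPath D n v w) : DPath D (m + n) u w := by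
  induction m generalizing u with
  | zero =>
    cases h₁
    simpa using h₂
  | succ m ih =>
    obtain ⟨x, hx, h⟩ := h₁
    rw [Nat.succ_add]
    exact ⟨x, hx, ih h⟩

/-- `v` is reachable from `u` by a directed walk of length at most `n`. -/
def ReachWithin (D : V → V → Prop) (n : ℕ) (u v : V) : Prop :=
  ∃ m ≤ n, DPath D m u v

theorem ReachWithin.trans {D : V → V → Prop} {m n : ℕ} {u v w : V} (h₁ : ReachWithin D m u v)
    (h₂ : ReachWithin D n v w) : ReachWithin D (m + n) u w := by
  obtain ⟨a, ha, h₁⟩ := h₁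
  obtain ⟨b, hb, h₂⟩ := h₂
  exact ⟨a + b, by omega, h₁.trans h₂⟩

theorem ReachWithin.mono {D : V → V → Prop} {m n : ℕ} {u v : V} (h : ReachWithin D m u v)
    (hmn : m ≤ n) : ReachWithin D n u v := by
  obtain ⟨a, ha, h⟩ := h
  exact ⟨a, ha.trans hmn, h⟩

theorem ReachWithin.single {D : V → V → Prop} {u v : V} (h : D u v) : ReachWithin D 1 u v :=
  ⟨1, le_rfl, v, h, rfl⟩

theorem ReachWithin.refl (D : V → V → Prop) (n : ℕ) (u : V) : ReachWithin D n u u :=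
  ⟨0, n.zero_le, rfl⟩

theorem ReachWithin.ddist_le {D : V → V → Prop} {n : ℕ} {u v : V} (h : ReachWithin D n u v) :
    ddist D u v ≤ n := by
  obtain ⟨m, hm, h⟩ := h
  have hle : ddist D u v ≤ m := sInf_le ⟨m, rfl, h⟩
  exact hle.trans (by exact_mod_cast hm)

theorem DPath.edist_fst_le {T : SimpleGraph V} {s : V → ℕ}
    {D : (Σ v : V, Fin (s v)) → (Σ v : V, Fin (s v)) → Prop}
    (hD : ∀ x y, D x y → T.Adj x.1 y.1) {m : ℕ} {x y : Σ v : V, Fin (s v)}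
    (h : DPath D m x y) : T.edist x.1 y.1 ≤ m := by
  induction m generalizing x with
  | zero =>
    cases h
    simp
  | succ m ih =>
    obtain ⟨z, hz, h⟩ := h
    calc T.edist x.1 y.1 ≤ T.edist x.1 z.1 + T.edist z.1 y.1 := T.edist_triangle
      _ ≤ 1 + m := add_le_add (edist_eq_one_iff_adj.2 (hD _ _ hz)).le (ih h)
      _ = ((m + 1 : ℕ) : ℕ∞) := by push_cast; rw [add_comm]

theorem ediam_le_orientNum_vertexMult (T : SimpleGraph V) {s : V → ℕ} (hs : ∀ v, 0 < s v) :
    T.ediam ≤ orientNum (vertexMult T s) := by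
  refine le_sInf ?_
  rintro _ ⟨D, hD, rfl⟩
  refine ediam_le_of_edist_le fun u v => ?_
  refine le_trans ?_ (le_iSup₂_of_le (f := fun x y => ddist D x y) ⟨u, 0, hs u⟩ ⟨v, 0, hs v⟩ le_rfl)
  refine le_sInf ?_
  rintro _ ⟨m, rfl, h⟩
  exact h.edist_fst_le (T := T) hD.1.1

/-! ### Layerings and the orientations they induce -/

/-- A layering of `T` around one central vertex or two adjacent ones, which is suitable for
orienting the vertex-multiplications of `T` with diameter at most `d`. -/
structure Layering (T : SimpleGraph V) (d : ℕ) where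
  /-- The central vertex that a vertex hangs from. -/
  root : V → V
  /-- The distance to the root. -/
  depth : V → ℕ
  /-- The first central vertex. -/
  fst : V
  /-- The second central vertex, possibly equal to the first. -/
  snd : V
  /-- A bound for the depth. -/
  height : ℕ
  three_le_height : 3 ≤ height
  root_cases : ∀ v, root v = fst ∨ root v = snd
  depth_root : ∀ v, depth (root v) = 0
  root_of_depth : ∀ v, depth v = 0 → root v = v
  exists_parent : ∀ v, depth v ≠ 0 → ∃ u, T.Adj u v ∧ depth u + 1 = depth v ∧ root u = root v
  root_ne : ∀ u v, T.Adj u v → depth u = depth v → root u ≠ root v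
  depth_le : ∀ v, depth v ≤ height
  exists_deep : ∀ v, ∃ w, root w = root v ∧ 2 ≤ depth w
  bound : 2 * height ≤ d
  adj_root : ∀ u v, root u ≠ root v → T.Adj (root u) (root v) ∧ 2 * height + 1 ≤ d

namespace Layering

variable {T : SimpleGraph V} {d : ℕ} (L : Layering T d) {s : V → ℕ}

/-- A vertex with a neighbour at depth two. -/
def IsBranch (v : V) : Prop := ∃ w, T.Adj v w ∧ L.depth w = 2

/-- For `y` in the layer below `x`, whether the edge between `x` and `y` points downwards. -/
def Down (x y : Σ v : V, Fin (s v)) : Prop :=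
  (L.depth y.1 = 1 ∧ L.IsBranch y.1 ∧ y.2.val = 0) ∨
  ((L.depth y.1 = 1 ∧ ¬ L.IsBranch y.1 ∨ L.depth y.1 = 2) ∧ x.2.val = 0) ∨
  (3 ≤ L.depth y.1 ∧ (x.2.val = 0 ↔ y.2.val = 0))

/-- The orientation of a vertex-multiplication of `T` induced by a layering of `T`. -/
def orient (x y : Σ v : V, Fin (s v)) : Prop :=
  T.Adj x.1 y.1 ∧
    (L.depth x.1 < L.depth y.1 ∧ L.Down x y ∨ L.depth y.1 < L.depth x.1 ∧ ¬ L.Down y x ∨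
      L.depth x.1 = L.depth y.1 ∧ (L.root x.1 = L.fst ↔ (x.2.val = 0 ↔ y.2.val = 0)))

theorem isOrientation_orient : IsOrientation (vertexMult T s) (L.orient (s := s)) := by
  refine ⟨fun _ _ h => h.1, fun x y h => ?_⟩
  have h₁ : T.Adj x.1 y.1 := h
  have h₂ := h₁.symm
  rcases lt_trichotomy (L.depth x.1) (L.depth y.1) with hlt | heq | hgt
  · simp [orient, h₁, h₂, hlt, hlt.not_gt, hlt.ne, hlt.ne']
  · have hr := L.root_ne _ _ h₁ heq
    have hx := L.root_cases x.1
    have hy := L.root_cases y.1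
    have hxy : L.root x.1 = L.fst ↔ ¬ L.root y.1 = L.fst := by grind
    have e₁ : L.orient x y ↔ (L.root x.1 = L.fst ↔ (x.2.val = 0 ↔ y.2.val = 0)) := by
      simp [orient, h₁, heq]
    have e₂ : L.orient y x ↔ (L.root y.1 = L.fst ↔ (y.2.val = 0 ↔ x.2.val = 0)) := by
      simp [orient, h₂, heq]
    rw [e₁, e₂, hxy]
    by_cases a : L.root y.1 = L.fst <;> by_cases b : x.2.val = 0 <;>
      by_cases c : y.2.val = 0 <;> simp only [a, b, c] <;> decide
  · simp [orient, h₁, h₂, hgt, hgt.not_gt, hgt.ne, hgt.ne']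

theorem orient_down {x y : Σ v : V, Fin (s v)} (h : T.Adj x.1 y.1)
    (hd : L.depth x.1 < L.depth y.1) (hxy : L.Down x y) : L.orient x y :=
  ⟨h, .inl ⟨hd, hxy⟩⟩

theorem orient_up {x y : Σ v : V, Fin (s v)} (h : T.Adj x.1 y.1)
    (hd : L.depth x.1 < L.depth y.1) (hxy : ¬ L.Down x y) : L.orient y x :=
  ⟨h.symm, .inr (.inl ⟨hd, hxy⟩)⟩

theorem adj_root_of_depth_eq_one {v : V} (h : L.depth v = 1) : T.Adj (L.root v) v := by
  obtain ⟨u, hu, hd, hr⟩ := L.exists_parent v (by omega)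
  rwa [← hr, L.root_of_depth u (by omega)]

theorem exists_depth_eq_two (v : V) : ∃ w, L.root w = L.root v ∧ L.depth w = 2 := by
  obtain ⟨w, hw, hd⟩ := L.exists_deep v
  obtain ⟨n, hn⟩ := Nat.exists_eq_add_of_le' hd
  induction n generalizing w with
  | zero => exact ⟨w, hw, by omega⟩
  | succ n ih =>
    obtain ⟨u, -, hu, hr⟩ := L.exists_parent w (by omega)
    exact ih u (hr.trans hw) (by omega) (by omega)

variable (hs : ∀ v, 2 ≤ s v)
include hs

theorem exists_copy_zero (v : V) : ∃ x : Σ v : V, Fin (s v), x.1 = v ∧ x.2.val = 0 :=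
  ⟨⟨v, 0, by have := hs v; omega⟩, rfl, rfl⟩

theorem exists_copy_one (v : V) : ∃ x : Σ v : V, Fin (s v), x.1 = v ∧ x.2.val = 1 :=
  ⟨⟨v, 1, by have := hs v; omega⟩, rfl, rfl⟩

theorem reach_root {x : Σ v : V, Fin (s v)} (hx : 2 ≤ L.depth x.1) {z : Σ v : V, Fin (s v)}
    (hz : z.1 = L.root x.1) : ReachWithin L.orient (L.depth x.1) x z := by
  obtain ⟨n, hn⟩ := Nat.exists_eq_add_of_le' hx
  induction n generalizing x with
  | zero =>
    obtain ⟨p, hp, hd, hr⟩ := L.exists_parent x.1 (by omega)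
    obtain ⟨y, rfl, hy⟩ := exists_copy_one hs p
    have hyd : L.depth y.1 = 1 := by omega
    have hbr : L.IsBranch y.1 := ⟨x.1, hp, by omega⟩
    have hz0 : L.depth z.1 = 0 := by rw [hz, L.depth_root]
    have h₁ : L.orient x y := L.orient_up hp (by omega) (by simp [Down, hn, hy])
    have h₂ : L.orient y z := by
      refine L.orient_up ?_ (by omega) (by simp [Down, hyd, hy, hbr])
      rw [hz, ← hr]
      exact L.adj_root_of_depth_eq_one hyd
    exact ((ReachWithin.single h₁).trans (.single h₂)).mono (by omega)
  | succ n ih =>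
    obtain ⟨p, hp, hd, hr⟩ := L.exists_parent x.1 (by omega)
    have : ∃ y : Σ v : V, Fin (s v), y.1 = p ∧ ¬ (y.2.val = 0 ↔ x.2.val = 0) := by
      by_cases h : x.2.val = 0
      · obtain ⟨y, hy, hy'⟩ := exists_copy_one hs p
        exact ⟨y, hy, by omega⟩
      · obtain ⟨y, hy, hy'⟩ := exists_copy_zero hs p
        exact ⟨y, hy, by omega⟩
    obtain ⟨y, rfl, hy⟩ := this
    have h₁ : L.orient x y := L.orient_up hp (by omega) (by unfold Down; omega)
    exact ((ReachWithin.single h₁).trans (ih (by omega) (hz.trans hr.symm) (by omega))).mono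
      (by omega)

theorem reach_of_root {x : Σ v : V, Fin (s v)} (hx : 2 ≤ L.depth x.1) {z : Σ v : V, Fin (s v)}
    (hz : z.1 = L.root x.1) : ReachWithin L.orient (L.depth x.1) z x := by
  obtain ⟨n, hn⟩ := Nat.exists_eq_add_of_le' hx
  induction n generalizing x with
  | zero =>
    obtain ⟨p, hp, hd, hr⟩ := L.exists_parent x.1 (by omega)
    obtain ⟨y, rfl, hy⟩ := exists_copy_zero hs p
    have hyd : L.depth y.1 = 1 := by omega
    have hbr : L.IsBranch y.1 := ⟨x.1, hp, by omega⟩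
    have hz0 : L.depth z.1 = 0 := by rw [hz, L.depth_root]
    have h₁ : L.orient y x := L.orient_down hp (by omega) (by simp [Down, hn, hy])
    have h₂ : L.orient z y := by
      refine L.orient_down ?_ (by omega) (by simp [Down, hyd, hy, hbr])
      rw [hz, ← hr]
      exact L.adj_root_of_depth_eq_one hyd
    exact ((ReachWithin.single h₂).trans (.single h₁)).mono (by omega)
  | succ n ih =>
    obtain ⟨p, hp, hd, hr⟩ := L.exists_parent x.1 (by omega)
    have : ∃ y : Σ v : V, Fin (s v), y.1 = p ∧ (y.2.val = 0 ↔ x.2.val = 0) := by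
      by_cases h : x.2.val = 0
      · obtain ⟨y, hy, hy'⟩ := exists_copy_zero hs p
        exact ⟨y, hy, by omega⟩
      · obtain ⟨y, hy, hy'⟩ := exists_copy_one hs p
        exact ⟨y, hy, by omega⟩
    obtain ⟨y, rfl, hy⟩ := this
    have h₁ : L.orient y x := L.orient_down hp (by omega) (by unfold Down; omega)
    exact ((ih (by omega) (hz.trans hr.symm) (by omega)).trans (ReachWithin.single h₁)).mono
      (by omega)

theorem reach_root_root {x y : Σ v : V, Fin (s v)} (hx : L.depth x.1 = 0) (hxy : x.1 = y.1) :
    ReachWithin L.orient 4 x y := by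
  obtain ⟨w, hw, hd⟩ := L.exists_depth_eq_two x.1
  obtain ⟨z, rfl, -⟩ := exists_copy_zero hs w
  rw [L.root_of_depth _ hx] at hw
  exact ((L.reach_of_root hs hd.ge hw.symm).trans
    (L.reach_root hs hd.ge (hxy.symm.trans hw.symm))).mono (by omega)

theorem reach_root_of_isBranch {x z : Σ v : V, Fin (s v)} (hx : L.depth x.1 = 1)
    (hbr : L.IsBranch x.1) (hz : z.1 = L.root x.1) : ReachWithin L.orient 3 x z := by
  have hadj := L.adj_root_of_depth_eq_one hx
  have hz0 : L.depth z.1 = 0 := by rw [hz, L.depth_root]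
  rw [← hz] at hadj
  by_cases h0 : x.2.val = 0
  · obtain ⟨w, hw, hwd⟩ := hbr
    obtain ⟨q, rfl, -⟩ := exists_copy_zero hs w
    obtain ⟨y, hy, hy1⟩ := exists_copy_one hs x.1
    have h₁ : L.orient x q := L.orient_down hw (by omega) (by simp [Down, hwd, h0])
    have h₂ : L.orient q y :=
      L.orient_up (hy ▸ hw) (by rw [hy]; omega) (by simp [Down, hwd, hy1])
    have h₃ : L.orient y z :=
      L.orient_up (hy ▸ hadj) (by rw [hy]; omega)
        (by simp [Down, hy, hx, hy1, show L.IsBranch x.1 from ⟨_, hw, hwd⟩])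
    exact ((ReachWithin.single h₁).trans (.single h₂)).trans (.single h₃)
  · exact (ReachWithin.single (L.orient_up hadj (by omega) (by simp [Down, hx, h0, hbr]))).mono
      (by omega)

theorem reach_of_root_of_isBranch {x z : Σ v : V, Fin (s v)} (hx : L.depth x.1 = 1)
    (hbr : L.IsBranch x.1) (hz : z.1 = L.root x.1) : ReachWithin L.orient 3 z x := by
  have hadj := L.adj_root_of_depth_eq_one hx
  have hz0 : L.depth z.1 = 0 := by rw [hz, L.depth_root]
  rw [← hz] at hadj
  by_cases h0 : x.2.val = 0
  · exact (ReachWithin.single (L.orient_down hadj (by omega) (by simp [Down, hx, h0, hbr]))).mono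
      (by omega)
  · obtain ⟨w, hw, hwd⟩ := hbr
    obtain ⟨q, rfl, -⟩ := exists_copy_zero hs w
    obtain ⟨y, hy, hy1⟩ := exists_copy_zero hs x.1
    have h₁ : L.orient q x := L.orient_up hw (by omega) (by simp [Down, hwd, h0])
    have h₂ : L.orient y q :=
      L.orient_down (hy ▸ hw) (by rw [hy]; omega) (by simp [Down, hwd, hy1])
    have h₃ : L.orient z y :=
      L.orient_down (hy ▸ hadj) (by rw [hy]; omega)
        (by simp [Down, hy, hx, hy1, show L.IsBranch x.1 from ⟨_, hw, hwd⟩])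
    exact ((ReachWithin.single h₃).trans (.single h₂)).trans (.single h₁)

/-- Either all copies of the root are close to `x` in both directions, or some of them are very
close while the others are not far away. -/
theorem reach_root_cases (x : Σ v : V, Fin (s v)) :
    (∀ z : Σ v : V, Fin (s v), z.1 = L.root x.1 →
      ReachWithin L.orient L.height x z ∧ ReachWithin L.orient L.height z x) ∨
    ((∀ z : Σ v : V, Fin (s v), z.1 = L.root x.1 →
      ReachWithin L.orient 5 x z ∧ ReachWithin L.orient 5 z x) ∧
     (∃ z : Σ v : V, Fin (s v), z.1 = L.root x.1 ∧ ReachWithin L.orient 1 x z) ∧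
     (∃ z : Σ v : V, Fin (s v), z.1 = L.root x.1 ∧ ReachWithin L.orient 1 z x)) := by
  have h3 := L.three_le_height
  by_cases h2 : 2 ≤ L.depth x.1
  · exact .inl fun z hz => ⟨(L.reach_root hs h2 hz).mono (L.depth_le _),
      (L.reach_of_root hs h2 hz).mono (L.depth_le _)⟩
  by_cases h0 : L.depth x.1 = 0
  · have hr := L.root_of_depth _ h0
    refine .inr ⟨fun z hz => ⟨?_, ?_⟩, ⟨x, hr.symm, .refl _ _ _⟩, ⟨x, hr.symm, .refl _ _ _⟩⟩
    · exact (L.reach_root_root hs h0 (hz.trans hr).symm).mono (by omega)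
    · exact (L.reach_root_root hs (by rw [hz, L.depth_root]) (hz.trans hr)).mono (by omega)
  have h1 : L.depth x.1 = 1 := by omega
  by_cases hbr : L.IsBranch x.1
  · exact .inl fun z hz => ⟨(L.reach_root_of_isBranch hs h1 hbr hz).mono h3,
      (L.reach_of_root_of_isBranch hs h1 hbr hz).mono h3⟩
  have hadj := L.adj_root_of_depth_eq_one h1
  have hd := L.depth_root x.1
  obtain ⟨a, ha, ha'⟩ := exists_copy_zero hs (L.root x.1)
  obtain ⟨b, hb, hb'⟩ := exists_copy_one hs (L.root x.1)
  have hax : ReachWithin L.orient 1 a x := .single <|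
    L.orient_down (ha ▸ hadj) (by rw [ha]; omega) (by simp [Down, h1, ha', hbr])
  have hxb : ReachWithin L.orient 1 x b := .single <|
    L.orient_up (hb ▸ hadj) (by rw [hb]; omega) (by simp [Down, h1, hb', hbr])
  refine .inr ⟨fun z hz => ⟨?_, ?_⟩, ⟨b, hb, hxb⟩, ⟨a, ha, hax⟩⟩
  · exact (hxb.trans (L.reach_root_root hs (by rw [hb, hd]) (hb.trans hz.symm))).mono (by omega)
  · exact ((L.reach_root_root hs (by rw [hz, hd]) (hz.trans ha.symm)).trans hax).mono (by omega)

theorem exists_orient_roots {x y : Σ v : V, Fin (s v)} (hx : L.depth x.1 = 0)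
    (hy : L.depth y.1 = 0) (hadj : T.Adj x.1 y.1) :
    (∃ z, z.1 = y.1 ∧ L.orient x z) ∧ ∃ z, z.1 = x.1 ∧ L.orient z y := by
  obtain ⟨a, ha, ha'⟩ := exists_copy_zero hs x.1
  obtain ⟨b, hb, hb'⟩ := exists_copy_one hs x.1
  obtain ⟨a₂, ha₂, ha₂'⟩ := exists_copy_zero hs y.1
  obtain ⟨b₂, hb₂, hb₂'⟩ := exists_copy_one hs y.1
  constructor
  · by_cases h : L.root x.1 = L.fst ↔ (x.2.val = 0)
    · exact ⟨a₂, ha₂, ha₂ ▸ hadj, .inr (.inr ⟨by rw [ha₂, hx, hy], by simp [ha₂', h]⟩)⟩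
    · exact ⟨b₂, hb₂, hb₂ ▸ hadj, .inr (.inr ⟨by rw [hb₂, hx, hy], by simp [hb₂']; tauto⟩)⟩
  · by_cases h : L.root x.1 = L.fst ↔ (y.2.val = 0)
    · exact ⟨a, ha, ha ▸ hadj, .inr (.inr ⟨by rw [ha, hx, hy], by simp [ha, ha', h]⟩)⟩
    · exact ⟨b, hb, hb ▸ hadj, .inr (.inr ⟨by rw [hb, hx, hy], by simp [hb, hb']; tauto⟩)⟩

/-- Walks through the centre, when all copies of the root of `x` are available. -/
theorem reach_via_target_root {x y z : Σ v : V, Fin (s v)} {m n : ℕ}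
    (hx : ∀ w : Σ v : V, Fin (s v), w.1 = L.root x.1 → ReachWithin L.orient m x w)
    (hz : z.1 = L.root y.1) (hzy : ReachWithin L.orient n z y)
    (hmn : m + n ≤ 2 * L.height) : ReachWithin L.orient d x y := by
  have hb := L.bound
  by_cases hr : L.root x.1 = L.root y.1
  · exact ((hx z (hz.trans hr.symm)).trans hzy).mono (by omega)
  · obtain ⟨hadj, hd⟩ := L.adj_root _ _ hr
    obtain ⟨a, ha, -⟩ := exists_copy_zero hs (L.root x.1)
    rw [← ha, ← hz] at hadj
    obtain ⟨-, b, hb, hbz⟩ := L.exists_orient_roots hs (by rw [ha, L.depth_root])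
      (by rw [hz, L.depth_root]) hadj
    exact (((hx b (hb.trans ha)).trans (.single hbz)).trans hzy).mono (by omega)

/-- Walks through the centre, when all copies of the root of `y` are available. -/
theorem reach_via_source_root {x y z : Σ v : V, Fin (s v)} {m n : ℕ}
    (hy : ∀ w : Σ v : V, Fin (s v), w.1 = L.root y.1 → ReachWithin L.orient n w y)
    (hz : z.1 = L.root x.1) (hxz : ReachWithin L.orient m x z)
    (hmn : m + n ≤ 2 * L.height) : ReachWithin L.orient d x y := by
  have hb := L.bound
  by_cases hr : L.root x.1 = L.root y.1
  · exact (hxz.trans (hy z (hz.trans hr))).mono (by omega)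
  · obtain ⟨hadj, hd⟩ := L.adj_root _ _ hr
    obtain ⟨a, ha, -⟩ := exists_copy_zero hs (L.root y.1)
    rw [← ha, ← hz] at hadj
    obtain ⟨⟨b, hb, hzb⟩, -⟩ := L.exists_orient_roots hs (by rw [hz, L.depth_root])
      (by rw [ha, L.depth_root]) hadj
    exact ((hxz.trans (.single hzb)).trans (hy b (hb.trans ha))).mono (by omega)

theorem reachWithin_orient (x y : Σ v : V, Fin (s v)) : ReachWithin L.orient d x y := by
  have h3 := L.three_le_height
  rcases L.reach_root_cases hs x with hx | ⟨hx, ⟨z, hz, hxz⟩, -⟩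
  · rcases L.reach_root_cases hs y with hy | ⟨-, -, w, hw, hwy⟩
    · obtain ⟨w, hw, -⟩ := exists_copy_zero hs (L.root y.1)
      exact L.reach_via_target_root hs (fun w hw => (hx w hw).1) hw (hy w hw).2 (by omega)
    · exact L.reach_via_target_root hs (fun w hw => (hx w hw).1) hw hwy (by omega)
  · rcases L.reach_root_cases hs y with hy | ⟨-, -, w, hw, hwy⟩
    · exact L.reach_via_source_root hs (fun w hw => (hy w hw).2) hz hxz (by omega)
    · exact L.reach_via_target_root hs (fun w hw => (hx w hw).1) hw hwy (by omega)

theorem orientNum_vertexMult_le (L : Layering T d) : orientNum (vertexMult T s) ≤ d := by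
  have hstrong : IsStrongOrientation (vertexMult T s) L.orient := by
    refine ⟨L.isOrientation_orient, fun x y => ?_⟩
    obtain ⟨m, -, h⟩ := L.reachWithin_orient hs x y
    exact ⟨m, h⟩
  have hle : orientNum (vertexMult T s) ≤ odiam L.orient := sInf_le ⟨_, hstrong, rfl⟩
  exact hle.trans (iSup₂_le fun x y => (L.reachWithin_orient hs x y).ddist_le)

end Layering

/-! ### Distances in trees -/

namespace SimpleGraph

theorem Connected.exists_adj_dist_add_one {G : SimpleGraph V} (hG : G.Connected) {a w : V}
    (h : G.dist a w ≠ 0) : ∃ b, G.Adj a b ∧ G.dist b w + 1 = G.dist a w := by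
  obtain ⟨p, hp⟩ := hG.exists_walk_length_eq_dist a w
  cases p with
  | nil => simp at h
  | @cons _ b _ hab q =>
    refine ⟨b, hab, ?_⟩
    have h₁ := dist_le q
    have h₂ : G.dist a w ≤ G.dist a b + G.dist b w := hG.dist_triangle
    rw [dist_eq_one_iff_adj.2 hab] at h₂
    rw [Walk.length_cons] at hp
    omega

theorem Connected.exists_dist_eq {G : SimpleGraph V} (hG : G.Connected) {u v : V} {m n : ℕ}
    (h : G.dist u v = m + n) : ∃ c, G.dist u c = m ∧ G.dist c v = n := by
  induction m generalizing u with
  | zero => exact ⟨u, by simp, by omega⟩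
  | succ m ih =>
    obtain ⟨b, hub, hb⟩ := hG.exists_adj_dist_add_one (a := u) (w := v) (by omega)
    obtain ⟨c, hbc, hcv⟩ := ih (u := b) (by omega)
    refine ⟨c, ?_, hcv⟩
    have h₁ : G.dist u c ≤ G.dist u b + G.dist b c := hG.dist_triangle
    have h₂ : G.dist u v ≤ G.dist u c + G.dist c v := hG.dist_triangle
    rw [dist_eq_one_iff_adj.2 hub] at h₁
    omega

theorem IsTree.eq_of_dist_add_one {T : SimpleGraph V} (hT : T.IsTree) {a b c w : V}
    (hb : T.Adj a b) (hc : T.Adj a c) (hbw : T.dist b w + 1 = T.dist a w)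
    (hcw : T.dist c w + 1 = T.dist a w) : b = c := by
  obtain ⟨p, hp⟩ := hT.connected.exists_walk_length_eq_dist b w
  obtain ⟨q, hq⟩ := hT.connected.exists_walk_length_eq_dist c w
  have hp' : (Walk.cons hb p).IsPath :=
    Walk.isPath_of_length_eq_dist _ (by rw [Walk.length_cons]; omega)
  have hq' : (Walk.cons hc q).IsPath :=
    Walk.isPath_of_length_eq_dist _ (by rw [Walk.length_cons]; omega)
  have := (hT.existsUnique_path a w).unique hp' hq'
  simp only [Walk.cons.injEq] at this
  exact this.1

theorem IsTree.dist_eq_of_adj_between {T : SimpleGraph V} (hT : T.IsTree) {a b x y : V}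
    (hab : T.Adj a b) (hx : T.dist b x = T.dist a x + 1) (hy : T.dist a y = T.dist b y + 1) :
    T.dist x y = T.dist a x + 1 + T.dist b y := by
  have hC := hT.connected
  induction hn : T.dist b y using Nat.strong_induction_on generalizing y with
  | _ n ih =>
  rcases n.eq_zero_or_pos with rfl | hpos
  · obtain rfl := hC.dist_eq_zero_iff.1 hn
    rw [dist_comm]
    omega
  obtain ⟨y', hyy', hy'⟩ := hC.exists_adj_dist_add_one (a := y) (w := b)
    (by rw [dist_comm]; omega)
  rw [dist_comm, dist_comm (u := y)] at hy'
  -- a neighbour of a vertex beyond `b` that is closer to `b` is itself beyond `b`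
  have beyond {y y' : V} (h : T.Adj y y') (hy : T.dist a y = T.dist b y + 1)
      (hd : T.dist b y' + 1 = T.dist b y) : T.dist a y' = T.dist b y' + 1 := by
    have h₁ : T.dist a y ≤ T.dist a y' + T.dist y' y := hC.dist_triangle
    have h₂ : T.dist a y' ≤ T.dist a b + T.dist b y' := hC.dist_triangle
    rw [dist_eq_one_iff_adj.2 h.symm] at h₁
    rw [dist_eq_one_iff_adj.2 hab] at h₂
    omega
  have hay' := beyond hyy' hy hy'
  have hxy' := ih (T.dist b y') (by omega) hay' rfl
  obtain ⟨z, hz, hzx, hzy⟩ : ∃ z, T.Adj y' z ∧ T.dist z x + 1 = T.dist y' x ∧ z ≠ y := by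
    rw [dist_comm (u := y'), hxy']
    by_cases h0 : T.dist b y' = 0
    · obtain rfl := hC.dist_eq_zero_iff.1 h0
      refine ⟨a, hab.symm, by omega, ?_⟩
      rintro rfl
      rw [dist_self] at hy
      omega
    · obtain ⟨z, hz, hzb⟩ := hC.exists_adj_dist_add_one (a := y') (w := b)
        (by rwa [dist_comm])
      rw [dist_comm, dist_comm (u := y')] at hzb
      refine ⟨z, hz, ?_, by rintro rfl; omega⟩
      rw [dist_comm, ih (T.dist b z) (by omega) (beyond hz hay' hzb) rfl]
      omega
  rcases hT.dist_eq_dist_add_one_of_adj x hyy' with h | h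
  · omega
  · refine absurd (hT.eq_of_dist_add_one hz hyy'.symm hzx ?_) hzy
    rw [dist_comm, dist_comm (u := y')]
    exact h.symm

end SimpleGraph

/-! ### Layerings of trees -/

open Classical in
/-- The closer one of two vertices. -/
noncomputable def closer (T : SimpleGraph V) (a b v : V) : V :=
  if T.dist a v ≤ T.dist b v then a else b

theorem closer_cases (T : SimpleGraph V) (a b v : V) :
    closer T a b v = a ∧ T.dist a v ≤ T.dist b v ∨
      closer T a b v = b ∧ T.dist b v < T.dist a v := by
  unfold closer
  split_ifs with h
  · exact .inl ⟨rfl, h⟩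
  · exact .inr ⟨rfl, by omega⟩

theorem dist_closer_le (T : SimpleGraph V) (a b v : V) :
    T.dist (closer T a b v) v ≤ T.dist a v ∧ T.dist (closer T a b v) v ≤ T.dist b v := by
  rcases closer_cases T a b v with ⟨h, h'⟩ | ⟨h, h'⟩ <;> rw [h] <;> omega

/-- The layering of a tree around two vertices, which are equal or adjacent. -/
noncomputable def layeringOfCenter {T : SimpleGraph V} (hT : T.IsTree) {d k : ℕ} (hk : 3 ≤ k)
    (hd : 2 * k ≤ d) (a b u v : V) (hab : a ≠ b → T.Adj a b ∧ 2 * k + 1 ≤ d)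
    (hle : ∀ w, T.dist a w ≤ k ∨ T.dist b w ≤ k)
    (hu : closer T a b u = a ∧ 2 ≤ T.dist a u) (hv : closer T a b v = b ∧ 2 ≤ T.dist b v) :
    Layering T d where
  root := closer T a b
  depth w := T.dist (closer T a b w) w
  fst := a
  snd := b
  height := k
  three_le_height := hk
  root_cases w := by
    rcases closer_cases T a b w with h | h
    · exact .inl h.1
    · exact .inr h.1
  depth_root w := by
    have := dist_closer_le T a b (closer T a b w)
    rcases closer_cases T a b w with ⟨h, -⟩ | ⟨h, -⟩ <;> rw [h] at this ⊢ <;>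
      simp only [SimpleGraph.dist_self] at this <;> omega
  root_of_depth w h := hT.connected.dist_eq_zero_iff.1 h
  exists_parent w h := by
    rw [SimpleGraph.dist_comm] at h
    obtain ⟨x, hx, hxd⟩ := hT.connected.exists_adj_dist_add_one h
    have key : closer T a b x = closer T a b w := by
      have h₁ : T.dist a w ≤ T.dist a x + T.dist x w := hT.connected.dist_triangle
      have h₂ : T.dist b w ≤ T.dist b x + T.dist x w := hT.connected.dist_triangle
      rw [SimpleGraph.dist_eq_one_iff_adj.2 hx.symm] at h₁ h₂
      rw [SimpleGraph.dist_comm, SimpleGraph.dist_comm (u := w)] at hxd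
      rcases closer_cases T a b w with ⟨hw, hw'⟩ | ⟨hw, hw'⟩ <;> rw [hw] at hxd ⊢ <;>
        rcases closer_cases T a b x with ⟨hx, hx'⟩ | ⟨hx, hx'⟩ <;> first | exact hx | omega
    refine ⟨x, hx.symm, ?_, key⟩
    rw [key, SimpleGraph.dist_comm, SimpleGraph.dist_comm (v := w)]
    exact hxd
  root_ne x y hxy h hr := hT.dist_ne_of_adj (closer T a b x) hxy (by rw [h, hr])
  depth_le w := by
    have := dist_closer_le T a b w
    rcases hle w with h | h <;> omega
  exists_deep w := by
    rcases closer_cases T a b w with ⟨h, -⟩ | ⟨h, -⟩ <;> rw [h]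
    · exact ⟨u, hu.1, by rw [hu.1]; exact hu.2⟩
    · exact ⟨v, hv.1, by rw [hv.1]; exact hv.2⟩
  bound := hd
  adj_root x y h := by
    rcases closer_cases T a b x with ⟨hx, -⟩ | ⟨hx, -⟩ <;>
      rcases closer_cases T a b y with ⟨hy, -⟩ | ⟨hy, -⟩ <;> rw [hx, hy] at h ⊢
    · exact absurd rfl h
    · exact hab h
    · exact ⟨(hab h.symm).1.symm, (hab h.symm).2⟩
    · exact absurd rfl h

theorem SimpleGraph.IsTree.dist_le_of_even_diam {T : SimpleGraph V} (hT : T.IsTree) {k : ℕ}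
    {u v c : V} (hmax : ∀ x y, T.dist x y ≤ 2 * k) (huv : T.dist u v = 2 * k)
    (huc : T.dist u c = k) (hcv : T.dist c v = k) (w : V) : T.dist c w ≤ k := by
  have hC := hT.connected
  by_cases hw : T.dist c w = 0
  · omega
  obtain ⟨b, hcb, hb⟩ := hC.exists_adj_dist_add_one hw
  have far {x : V} (hx : T.dist c x = k) (h : T.dist b x = T.dist c x + 1) : T.dist c w ≤ k := by
    have := hT.dist_eq_of_adj_between hcb h hb.symm
    have := hmax x w
    omega
  rw [SimpleGraph.dist_comm] at huc
  rcases hT.dist_eq_dist_add_one_of_adj u hcb with hu | hu <;>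
    rw [SimpleGraph.dist_comm, SimpleGraph.dist_comm (u := u)] at hu
  · rcases hT.dist_eq_dist_add_one_of_adj v hcb with hv | hv <;>
      rw [SimpleGraph.dist_comm, SimpleGraph.dist_comm (u := v)] at hv
    · have : T.dist u v ≤ T.dist u b + T.dist b v := hC.dist_triangle
      rw [SimpleGraph.dist_comm (u := u) (v := b)] at this
      omega
    · exact far hcv hv
  · exact far huc hu

theorem SimpleGraph.IsTree.nonempty_layering {T : SimpleGraph V} (hT : T.IsTree) {d : ℕ}
    (hd : 6 ≤ d) {u v : V} (huv : T.dist u v = d) (hmax : ∀ x y, T.dist x y ≤ d) :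
    Nonempty (Layering T d) := by
  have hC := hT.connected
  obtain ⟨k, rfl | rfl⟩ := d.even_or_odd'
  · obtain ⟨c, huc, hcv⟩ := hC.exists_dist_eq (m := k) (n := k) (by omega : T.dist u v = k + k)
    have hc : closer T c c v = c ∧ 2 ≤ T.dist c v := ⟨by simp [closer], by omega⟩
    exact ⟨layeringOfCenter hT (by omega) le_rfl c c v v (fun h => absurd rfl h)
      (fun w => .inl (hT.dist_le_of_even_diam hmax huv huc hcv w)) hc hc⟩
  · obtain ⟨a, hua, hav⟩ := hC.exists_dist_eq (m := k) (n := k + 1)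
      (by omega : T.dist u v = k + (k + 1))
    obtain ⟨b, hab, hbv⟩ := hC.exists_adj_dist_add_one (a := a) (w := v) (by omega)
    have hub : T.dist b u = T.dist a u + 1 := by
      have h₁ : T.dist u v ≤ T.dist u b + T.dist b v := hC.dist_triangle
      have h₂ : T.dist u b ≤ T.dist u a + T.dist a b := hC.dist_triangle
      rw [dist_eq_one_iff_adj.2 hab] at h₂
      rw [SimpleGraph.dist_comm, SimpleGraph.dist_comm (u := a)]
      omega
    rw [SimpleGraph.dist_comm] at hua
    refine ⟨layeringOfCenter hT (k := k) (by omega) (by omega) a b u v (fun _ => ⟨hab, le_rfl⟩)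
      (fun w => ?_) ⟨if_pos (by omega), by omega⟩ ⟨if_neg (by omega), by omega⟩⟩
    rcases hT.dist_eq_dist_add_one_of_adj w hab with h | h <;>
      rw [SimpleGraph.dist_comm, SimpleGraph.dist_comm (u := w)] at h
    · have := hT.dist_eq_of_adj_between hab hub h
      have := hmax u w
      omega
    · have := hT.dist_eq_of_adj_between hab h hbv.symm
      have := hmax w v
      omega

theorem stmt17 [Fintype V] (T : SimpleGraph V) (hT : T.IsTree) (hdiam : 6 ≤ T.ediam)
    (s : V → ℕ) (hs : ∀ v, 2 ≤ s v) :
    orientNum (vertexMult T s) = T.ediam := by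
  have hC := hT.connected
  have := hC.nonempty
  refine le_antisymm ?_ (ediam_le_orientNum_vertexMult T fun v => by have := hs v; omega)
  have htop : T.ediam ≠ ⊤ := connected_iff_ediam_ne_top.1 hC
  obtain ⟨u, v, huv⟩ := T.exists_dist_eq_diam
  have hcoe : (T.diam : ℕ∞) = T.ediam := ENat.natCast_toNat htop
  rw [← hcoe] at hdiam ⊢
  obtain ⟨L⟩ := hT.nonempty_layering (by exact_mod_cast hdiam) huv fun _ _ => dist_le_diam htop
  exact L.orientNum_vertexMult_le hs
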